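/- arXiv:cs/0410043 — 4 statements merged into one kernel-verified Lean document; each statement's English description precedes it below -/
import Mathlib

section
/- For every natural number n ≥ 1 and every natural number r ≥ 4, there exists an r-bit binary tree code of depth n whose distance function D satisfies: D(l) = l if l ≤ r, D(l) = r if r < l ≤ 2r, and D(l) ≥ l/2 if l > 2r. That is, there exists a labeling L assigning to every nonempty binary string of length at most n a vector in F₂^r such that for any two distinct binary strings a = a'₁…a'_h and b = b'₁…b'_h of equal length h ≤ n whose longest common prefix has length h − l, the number of indices i with h − l < i ≤ h and L(a'₁…a'_i) ≠ L(b'₁…b'_i) is at least l when l ≤ r, at least r when r < l ≤ 2r, and at least l/2 when l > 2r. -/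
open Finset in
/-- The difference, `m` levels below the first branching arc, of the labels of two branches of the
time-invariant linear code generated by `A`, when the branches disagree at the arc where they split
and then exactly at the arcs indexed by `T`. -/
def branchDiff {V : Type*} [AddCommGroup V] (A : ℕ → V) (T : Finset ℕ) (m : ℕ) : V :=
  A m + ∑ j ∈ range m, if j ∈ T then A (m - 1 - j) else 0

/-- The weight of a label difference: vanishing differences are penalised. -/
noncomputable def zeroWeight {V : Type*} [AddCommGroup V] [DecidableEq V] (x : V) : ℝ :=
  if x = 0 then 4 else 1 / 4

open Finset in
/-- The sum over all disagreement patterns `T` of the weights of the first `k` differences. -/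
noncomputable def codePotential {V : Type*} [AddCommGroup V] [DecidableEq V]
    (A : ℕ → V) (k : ℕ) : ℝ :=
  ∑ T ∈ (range k).powerset, ∏ m ∈ range k, zeroWeight (branchDiff A T m)

section

open Finset

variable {V : Type*} [AddCommGroup V]

lemma branchDiff_congr {A B : ℕ → V} {S T : Finset ℕ} {m : ℕ} (hA : ∀ i ≤ m, A i = B i)
    (hT : ∀ j < m, j ∈ S ↔ j ∈ T) : branchDiff A S m = branchDiff B T m := by
  unfold branchDiff
  rw [hA m le_rfl]
  congr 1
  refine sum_congr rfl fun j hj => ?_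
  rw [mem_range] at hj
  simp only [hT j hj, hA (m - 1 - j) (by omega)]

variable [DecidableEq V]

lemma zeroWeight_pos (x : V) : 0 < zeroWeight x := by
  unfold zeroWeight
  split_ifs <;> norm_num

lemma codePotential_congr {A B : ℕ → V} {k : ℕ} (h : ∀ i < k, A i = B i) :
    codePotential A k = codePotential B k := by
  unfold codePotential
  refine sum_congr rfl fun T _ => prod_congr rfl fun m hm => ?_
  rw [mem_range] at hm
  rw [branchDiff_congr (fun i hi => h i (by omega)) fun _ _ => Iff.rfl]

lemma codePotential_succ (A : ℕ → V) (k : ℕ) :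
    codePotential A (k + 1) = 2 * ∑ T ∈ (range k).powerset,
      (∏ m ∈ range k, zeroWeight (branchDiff A T m)) * zeroWeight (branchDiff A T k) := by
  have hins : ∀ T : Finset ℕ, ∏ m ∈ range (k + 1), zeroWeight (branchDiff A (insert k T) m)
      = ∏ m ∈ range (k + 1), zeroWeight (branchDiff A T m) := fun T =>
    prod_congr rfl fun m hm => by
      rw [mem_range] at hm
      refine congrArg zeroWeight (branchDiff_congr (fun _ _ => rfl) fun j hj => ?_)
      simp [show j ≠ k by omega]
  unfold codePotential
  rw [range_add_one, sum_powerset_insert notMem_range_self, ← range_add_one]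
  simp only [hins, prod_range_succ]
  ring

lemma codePotential_succ_le_of_forall_ne_zero {A : ℕ → V} {k : ℕ}
    (h : ∀ T, branchDiff A T k ≠ 0) : codePotential A (k + 1) ≤ codePotential A k := by
  have hnonneg : 0 ≤ codePotential A k :=
    sum_nonneg fun T _ => prod_nonneg fun m _ => (zeroWeight_pos _).le
  have hw : ∀ T, zeroWeight (branchDiff A T k) = 1 / 4 := fun T => by simp [zeroWeight, h T]
  rw [codePotential_succ]
  simp only [hw, ← sum_mul]
  change 2 * (codePotential A k * (1 / 4)) ≤ _
  linarith

lemma sum_zeroWeight_add_le [Fintype V] (hV : 16 ≤ Fintype.card V) (c : V) :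
    2 * ∑ v : V, zeroWeight (v + c) ≤ Fintype.card V := by
  have hV' : (16 : ℝ) ≤ Fintype.card V := by exact_mod_cast hV
  have h : ∀ v : V, zeroWeight v = 1 / 4 + if v = 0 then 15 / 4 else 0 := fun v => by
    unfold zeroWeight
    split_ifs <;> norm_num
  rw [Fintype.sum_equiv (Equiv.addRight c) (fun v => zeroWeight (v + c)) zeroWeight
    fun _ => rfl]
  simp only [h, sum_add_distrib, sum_ite_eq', sum_const, card_univ, nsmul_eq_mul, mem_univ,
    if_true]
  linarith

lemma exists_codePotential_update_succ_le [Fintype V] (hV : 16 ≤ Fintype.card V) (A : ℕ → V)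
    (k : ℕ) : ∃ v, codePotential (Function.update A k v) (k + 1) ≤ codePotential A k := by
  have hdiff : ∀ (v : V) (T : Finset ℕ), branchDiff (Function.update A k v) T k
      = v + ∑ j ∈ range k, if j ∈ T then A (k - 1 - j) else 0 := fun v T => by
    unfold branchDiff
    rw [Function.update_self]
    congr 1
    refine sum_congr rfl fun j hj => ?_
    rw [mem_range] at hj
    rw [Function.update_of_ne (by omega)]
  have hprod : ∀ (v : V) (T : Finset ℕ),
      ∏ m ∈ range k, zeroWeight (branchDiff (Function.update A k v) T m)
        = ∏ m ∈ range k, zeroWeight (branchDiff A T m) := fun v T =>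
    prod_congr rfl fun m hm => by
      rw [mem_range] at hm
      exact congrArg zeroWeight (branchDiff_congr
        (fun i hi => Function.update_of_ne (by omega) _ _) fun _ _ => Iff.rfl)
  have hsum : ∑ v : V, codePotential (Function.update A k v) (k + 1)
      ≤ ∑ _v : V, codePotential A k := by
    simp only [codePotential_succ, hprod, hdiff]
    rw [← mul_sum, sum_comm, mul_sum, sum_const, card_univ, nsmul_eq_mul, codePotential, mul_sum]
    refine sum_le_sum fun T _ => ?_
    rw [← mul_sum, mul_left_comm, mul_comm (Fintype.card V : ℝ)]
    exact mul_le_mul_of_nonneg_left (sum_zeroWeight_add_le hV _)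
      (prod_nonneg fun m _ => (zeroWeight_pos _).le)
  obtain ⟨v, -, hv⟩ := exists_le_of_sum_le ⟨0, mem_univ _⟩ hsum
  exact ⟨v, hv⟩

lemma two_mul_card_branchDiff_ne_zero_ge {A : ℕ → V} {k : ℕ} (h : codePotential A k ≤ 1)
    {T : Finset ℕ} (hT : T ⊆ range k) : k ≤ 2 * #{m ∈ range k | branchDiff A T m ≠ 0} := by
  have hle : ∏ m ∈ range k, zeroWeight (branchDiff A T m) ≤ 1 :=
    (single_le_sum (f := fun T => ∏ m ∈ range k, zeroWeight (branchDiff A T m))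
      (fun T _ => prod_nonneg fun m _ => (zeroWeight_pos _).le) (mem_powerset.2 hT)).trans h
  have hcard := card_filter_add_card_filter_not (s := range k) fun m => branchDiff A T m = 0
  rw [card_range] at hcard
  simp only [zeroWeight, prod_ite, prod_const] at hle
  rw [one_div, inv_pow, ← div_eq_mul_inv, div_le_one (by positivity)] at hle
  have := (pow_le_pow_iff_right₀ (by norm_num : (1 : ℝ) < 4)).1 hle
  simp only [ne_eq]
  omega

end

section

open Finset

lemma branchDiff_ne_zero_of_eq_indicator {r : ℕ} {A : ℕ → Fin r → ZMod 2}
    (hA : ∀ i < r, A i = fun c : Fin r => if (c : ℕ) = i then 1 else 0) {m : ℕ} (hm : m < r)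
    (T : Finset ℕ) : branchDiff A T m ≠ 0 := by
  intro h
  have h' := congrFun h ⟨m, hm⟩
  rw [branchDiff, Pi.add_apply, Finset.sum_apply, sum_eq_zero, hA m hm] at h'
  · simp at h'
  · intro j hj
    rw [mem_range] at hj
    rw [hA (m - 1 - j) (by omega)]
    split_ifs
    · simp only [ite_eq_right_iff]
      omega
    · rfl

lemma exists_codePotential_le_one {r : ℕ} (hr : 4 ≤ r) (k : ℕ) :
    ∃ A : ℕ → Fin r → ZMod 2, (∀ i < r, A i = fun c : Fin r => if (c : ℕ) = i then 1 else 0) ∧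
      ∀ j ≤ k, codePotential A j ≤ 1 := by
  induction k with
  | zero =>
    refine ⟨fun i c => if (c : ℕ) = i then 1 else 0, fun _ _ => rfl, fun j hj => ?_⟩
    obtain rfl : j = 0 := by omega
    simp [codePotential]
  | succ k ih =>
    obtain ⟨A, hA, hk⟩ := ih
    by_cases hkr : k < r
    · refine ⟨A, hA, fun j hj => ?_⟩
      rcases hj.lt_or_eq with hj | rfl
      · exact hk j (by omega)
      · exact (codePotential_succ_le_of_forall_ne_zero
          (branchDiff_ne_zero_of_eq_indicator hA hkr)).trans (hk k le_rfl)
    · have hV : 16 ≤ Fintype.card (Fin r → ZMod 2) := by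
        simpa using Nat.pow_le_pow_right (n := 2) (by norm_num) hr
      obtain ⟨v, hv⟩ := exists_codePotential_update_succ_le hV A k
      refine ⟨Function.update A k v, fun i hi => ?_, fun j hj => ?_⟩
      · rw [Function.update_of_ne (by omega), hA i hi]
      · rcases hj.lt_or_eq with hj | rfl
        · rw [codePotential_congr fun i hi => Function.update_of_ne (by omega) v A]
          exact hk j (by omega)
        · exact hv.trans (hk k le_rfl)

/-- The labeling of the binary tree by the time-invariant linear code generated by `A`. -/
def convolutionLabel {V : Type*} [AddCommGroup V] (A : ℕ → V) (w : List Bool) : V :=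
  ∑ j ∈ range w.length, if w.getD j false then A (w.length - 1 - j) else 0

lemma convolutionLabel_take {V : Type*} [AddCommGroup V] (A : ℕ → V) {w : List Bool} {i : ℕ}
    (hi : i ≤ w.length) : convolutionLabel A (w.take i)
      = ∑ j ∈ range i, if w.getD j false then A (i - 1 - j) else 0 := by
  unfold convolutionLabel
  rw [List.length_take_of_le hi]
  refine sum_congr rfl fun j hj => ?_
  rw [mem_range] at hj
  simp [List.getD_eq_getElem?_getD, hj]

lemma convolutionLabel_take_sub_take {r : ℕ} (A : ℕ → Fin r → ZMod 2) {a b : List Bool}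
    {p l m : ℕ} (ha : a.length = p + l) (hb : b.length = p + l) (hm : m < l)
    (heq : ∀ j < p, a.getD j false = b.getD j false) (hne : a.getD p false ≠ b.getD p false) :
    convolutionLabel A (a.take (p + 1 + m)) - convolutionLabel A (b.take (p + 1 + m))
      = branchDiff A {j ∈ range l | a.getD (p + 1 + j) false ≠ b.getD (p + 1 + j) false} m := by
  have hsub : ∀ (s t : Bool) (v : Fin r → ZMod 2),
      ((if s then v else 0) - if t then v else 0) = if s ≠ t then v else 0 := fun s t v => by
    have hv : -v = v := by
      ext c
      simp [ZMod.neg_eq_self_mod_two]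
    cases s <;> cases t <;> simp [hv]
  rw [convolutionLabel_take A (by omega), convolutionLabel_take A (by omega),
    ← sum_sub_distrib]
  simp only [hsub]
  rw [sum_range_add, sum_range_succ, sum_eq_zero, zero_add, if_pos hne, branchDiff]
  · congr 1
    · congr 1
      omega
    · refine sum_congr rfl fun j hj => ?_
      rw [mem_range] at hj
      simp only [mem_filter, mem_range, show j < l by omega, true_and]
      rw [show p + 1 + m - 1 - (p + 1 + j) = m - 1 - j by omega]
  · intro j hj
    rw [mem_range] at hj
    rw [if_neg (not_not.2 (heq j hj))]

lemma card_filter_Icc_convolutionLabel_ne {r : ℕ} (A : ℕ → Fin r → ZMod 2) {a b : List Bool}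
    {p l : ℕ} (ha : a.length = p + l) (hb : b.length = p + l)
    (heq : ∀ j < p, a.getD j false = b.getD j false) (hne : a.getD p false ≠ b.getD p false) :
    #{i ∈ Icc (p + 1) (p + l) | convolutionLabel A (a.take i) ≠ convolutionLabel A (b.take i)}
      = #{m ∈ range l | branchDiff A
          {j ∈ range l | a.getD (p + 1 + j) false ≠ b.getD (p + 1 + j) false} m ≠ 0} := by
  symm
  refine card_bij (fun m _ => p + 1 + m) ?_ (fun _ _ _ _ h => by omega) ?_
  · intro m hm
    rw [mem_filter, mem_range] at hm
    rw [mem_filter, mem_Icc, ← sub_ne_zero,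
      convolutionLabel_take_sub_take A ha hb hm.1 heq hne]
    exact ⟨by omega, hm.2⟩
  · intro i hi
    rw [mem_filter, mem_Icc] at hi
    obtain ⟨m, rfl⟩ := Nat.exists_eq_add_of_le hi.1.1
    refine ⟨m, ?_, rfl⟩
    have hm : m < l := by omega
    rw [← sub_ne_zero, convolutionLabel_take_sub_take A ha hb hm heq hne] at hi
    rw [mem_filter, mem_range]
    exact ⟨hm, hi.2⟩

end

/-- Main theorem of Section 2: for every `n ≥ 1` and `r ≥ 4` there is an
`r`-bit binary tree code of depth `n` with distance function `D(l) = l` for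
`l ≤ r`, `D(l) = r` for `r < l ≤ 2r`, and `D(l) ≥ l/2` for `l > 2r`.

A labeling assigns to each nonempty binary string (node of the complete
binary tree, reached by the string from the root) a vector in `F₂^r`; for two
distinct strings `a, b` of common length `h ≤ n` whose longest common prefix
has length `h - l` (so `1 ≤ l ≤ h`), the number of indices `i` with
`h - l < i ≤ h` at which the labels of the length-`i` prefixes of `a` and `b`
differ is at least `D(l)`. -/
theorem exists_r_bit_binary_tree_code (n r : ℕ) (hn : 1 ≤ n) (hr : 4 ≤ r) :
    ∃ L : List Bool → (Fin r → ZMod 2),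
      ∀ (h l : ℕ) (a b : List Bool),
        a.length = h → b.length = h → h ≤ n → 1 ≤ l → l ≤ h →
        a.take (h - l) = b.take (h - l) →
        a.take (h - l + 1) ≠ b.take (h - l + 1) →
        (if l ≤ r then (l : ℝ) else if l ≤ 2 * r then (r : ℝ) else (l : ℝ) / 2)
          ≤ (((Finset.Icc (h - l + 1) h).filter
              (fun i => L (a.take i) ≠ L (b.take i))).card : ℝ) := by
  obtain ⟨A, hA, hpot⟩ := exists_codePotential_le_one hr n
  refine ⟨convolutionLabel A, fun h l a b ha hb hh hl hlh htake htake' => ?_⟩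
  obtain ⟨p, rfl⟩ := Nat.exists_eq_add_of_le' hlh
  simp only [Nat.add_sub_cancel] at htake htake' ⊢
  have heq : ∀ j < p, a.getD j false = b.getD j false := fun j hj => by
    have := congrArg (fun w : List Bool => w.getD j false) htake
    simpa [List.getD_eq_getElem?_getD, List.getElem?_take, hj] using this
  have hne : a.getD p false ≠ b.getD p false := fun hp => htake' <| by
    have hpa : p < a.length := by omega
    have hpb : p < b.length := by omega
    rw [List.getD_eq_getElem _ _ hpa, List.getD_eq_getElem _ _ hpb] at hp
    rw [List.take_add_one, List.take_add_one, htake, List.getElem?_eq_getElem hpa,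
      List.getElem?_eq_getElem hpb, hp]
  rw [card_filter_Icc_convolutionLabel_ne A ha hb heq hne]
  set T := (Finset.range l).filter
    fun j => a.getD (p + 1 + j) false ≠ b.getD (p + 1 + j) false
  have hmin : min l r ≤ ((Finset.range l).filter fun m => branchDiff A T m ≠ 0).card := by
    rw [← Finset.card_range (min l r)]
    refine Finset.card_le_card fun m hm => ?_
    rw [Finset.mem_range] at hm
    rw [Finset.mem_filter, Finset.mem_range]
    exact ⟨by omega, branchDiff_ne_zero_of_eq_indicator hA (by omega) T⟩
  have hhalf := two_mul_card_branchDiff_ne_zero_ge (hpot l (by omega))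
    (Finset.filter_subset _ _ : T ⊆ Finset.range l)
  split_ifs with h₁ h₂
  · exact_mod_cast (min_eq_left h₁).symm.le.trans hmin
  · exact_mod_cast (min_eq_right (not_le.1 h₁).le).symm.le.trans hmin
  · rw [div_le_iff₀ two_pos, mul_comm]
    exact_mod_cast hhalf
end

section
/- For every natural number n ≥ 1, there exists a binary tree code of depth n over an alphabet of size 16 with distance parameter 1/2: a labeling L assigning to every nonempty binary string of length at most n a vector in F₂^4 such that for any two distinct binary strings a = a'₁…a'_h and b = b'₁…b'_h of equal length h ≤ n whose longest common prefix has length h − l, the number of indices i with h − l < i ≤ h and L(a'₁…a'_i) ≠ L(b'₁…b'_i) is at least l/2. -/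
namespace BinaryTreeCode

variable {V : Type*} [AddCommGroup V]

/-- The entry at position `m` of the convolution of `g` with the binary sequence that starts with
`1` and whose later ones are at the positions `k + 1` for `k ∈ A`. -/
def conv (g : ℕ → V) (A : Finset ℕ) (m : ℕ) : V :=
  g m + ∑ k ∈ Finset.range m, if k ∈ A then g (m - 1 - k) else 0

/-- The label of a binary string under the time-invariant linear code generated by `g`. -/
def encode (g : ℕ → V) (a : List Bool) : V :=
  ∑ j ∈ Finset.range a.length, if a.getD j false then g (a.length - 1 - j) else 0

lemma conv_congr {g g' : ℕ → V} {A A' : Finset ℕ} {m : ℕ} (hg : ∀ k ≤ m, g k = g' k)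
    (hA : ∀ k < m, k ∈ A ↔ k ∈ A') : conv g A m = conv g' A' m := by
  unfold conv
  rw [hg m le_rfl]
  congr 1
  refine Finset.sum_congr rfl fun k hk => ?_
  simp only [hA k (Finset.mem_range.1 hk), hg (m - 1 - k) (by omega)]

lemma conv_update_self (g : ℕ → V) (A : Finset ℕ) (m : ℕ) (v : V) :
    conv (Function.update g m v) A m =
      v + ∑ k ∈ Finset.range m, if k ∈ A then g (m - 1 - k) else 0 := by
  unfold conv
  rw [Function.update_self]
  congr 1
  refine Finset.sum_congr rfl fun k hk => ?_
  have := Finset.mem_range.1 hk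
  rw [Function.update_of_ne (by omega)]

/-- In characteristic two, the difference of the labels of two strings is the convolution entry
given by the positions at which the strings differ. -/
lemma encode_take_sub_encode_take (hV : ∀ v : V, v + v = 0) (g : ℕ → V) {a b : List Bool}
    {h p m : ℕ} (ha : a.length = h) (hb : b.length = h) (hm : p + m + 1 ≤ h)
    (hpre : a.take p = b.take p) (hne : a.take (p + 1) ≠ b.take (p + 1)) :
    encode g (a.take (p + m + 1)) - encode g (b.take (p + m + 1)) =
      conv g ((Finset.range h).filter
        fun k => a.getD (p + 1 + k) false ≠ b.getD (p + 1 + k) false) m := by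
  have hlt : ∀ c : List Bool, ∀ j < p + m + 1,
      (c.take (p + m + 1)).getD j false = c.getD j false := fun c j hj => by
    simp [List.getD_eq_getElem?_getD, hj]
  have hdiff : encode g (a.take (p + m + 1)) - encode g (b.take (p + m + 1)) =
      ∑ j ∈ Finset.range (p + (m + 1)),
        if a.getD j false ≠ b.getD j false then g (p + m - j) else 0 := by
    unfold encode
    rw [List.length_take, List.length_take, ha, hb, min_eq_left hm, ← Finset.sum_sub_distrib]
    refine Finset.sum_congr rfl fun j hj => ?_
    rw [hlt a j (Finset.mem_range.1 hj), hlt b j (Finset.mem_range.1 hj)]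
    have hneg : -g (p + m - j) = g (p + m - j) := neg_eq_of_add_eq_zero_left (hV _)
    cases a.getD j false <;> cases b.getD j false <;> simp [hneg]
  have hagree : ∀ j < p, a.getD j false = b.getD j false := fun j hj => by
    have := congrArg (fun l : List Bool => l[j]?) hpre
    simp only [List.getElem?_take, hj, if_true] at this
    rw [List.getD_eq_getElem?_getD, List.getD_eq_getElem?_getD, this]
  have hdis : a.getD p false ≠ b.getD p false := fun heq => hne <| by
    rw [List.take_add_one, List.take_add_one, hpre]
    congr 2
    rw [List.getD_eq_getElem?_getD, List.getD_eq_getElem?_getD] at heq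
    rw [List.getElem?_eq_getElem (by omega), List.getElem?_eq_getElem (by omega)] at heq ⊢
    simpa using heq
  rw [hdiff, Finset.sum_range_add, Finset.sum_eq_zero, zero_add, Finset.sum_range_succ', add_zero,
    if_pos hdis, add_comm, conv, show p + m - p = m by omega]
  · congr 1
    refine Finset.sum_congr rfl fun k hk => ?_
    have := Finset.mem_range.1 hk
    rw [show p + (k + 1) = p + 1 + k by omega, show p + m - (p + 1 + k) = m - 1 - k by omega]
    simp [show k < h by omega]
  · intro j hj
    rw [if_neg (not_not.2 (hagree j (Finset.mem_range.1 hj)))]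

variable [DecidableEq V]

/-- The penalty of a label difference: large exactly when the labels agree. -/
noncomputable def penalty (v : V) : ℝ := if v = 0 then 5 else 5⁻¹

lemma penalty_pos (v : V) : 0 < penalty v := by
  unfold penalty; split_ifs <;> norm_num

/-- The total penalty of the convolution entries at positions `1, …, t`. -/
noncomputable def weight (g : ℕ → V) (A : Finset ℕ) (t : ℕ) : ℝ :=
  ∏ m ∈ Finset.range t, penalty (conv g A (m + 1))

lemma weight_pos (g : ℕ → V) (A : Finset ℕ) (t : ℕ) : 0 < weight g A t :=
  Finset.prod_pos fun _ _ => penalty_pos _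

lemma weight_congr {g g' : ℕ → V} {A A' : Finset ℕ} {t : ℕ} (hg : ∀ k ≤ t, g k = g' k)
    (hA : ∀ k < t, k ∈ A ↔ k ∈ A') : weight g A t = weight g' A' t := by
  refine Finset.prod_congr rfl fun m hm => ?_
  have := Finset.mem_range.1 hm
  rw [conv_congr (fun k hk => hg k (by omega)) (fun k hk => hA k (by omega))]

lemma sum_penalty_add [Fintype V] (hV : 16 ≤ Fintype.card V) (u : V) :
    ∑ v : V, penalty (v + u) ≤ Fintype.card V / 2 := by
  have h16 : (16 : ℝ) ≤ Fintype.card V := by exact_mod_cast hV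
  have hsplit : ∀ v : V, penalty v = 5⁻¹ + if v = 0 then (24 / 5 : ℝ) else 0 := fun v => by
    unfold penalty; split_ifs <;> norm_num
  rw [Fintype.sum_equiv (Equiv.addRight u) (fun v => penalty (v + u)) penalty fun _ => rfl]
  simp only [hsplit, Finset.sum_add_distrib, Finset.sum_const, Finset.card_univ, nsmul_eq_mul,
    Finset.sum_ite_eq', Finset.mem_univ, if_true]
  linarith

/-- Greedy choice of the generator: the next coefficient can be chosen so that the sum of the
weights over all binary sequences does not increase. -/
lemma exists_sum_weight_le_one [Fintype V] (hV : 16 ≤ Fintype.card V) (t : ℕ) :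
    ∃ g : ℕ → V, g 0 ≠ 0 ∧ ∀ s ≤ t, ∑ A ∈ (Finset.range s).powerset, weight g A s ≤ 1 := by
  induction t with
  | zero =>
    have : Nontrivial V := Fintype.one_lt_card_iff_nontrivial.1 (by omega)
    obtain ⟨v, hv⟩ := exists_ne (0 : V)
    exact ⟨fun _ => v, hv, fun s hs => by simp [Nat.le_zero.1 hs, weight]⟩
  | succ t ih =>
    obtain ⟨g, hg0, hg⟩ := ih
    let u : Finset ℕ → V := fun A =>
      ∑ k ∈ Finset.range (t + 1), if k ∈ A then g (t + 1 - 1 - k) else 0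
    have hweight : ∀ v, ∑ A ∈ (Finset.range (t + 1)).powerset,
        weight (Function.update g (t + 1) v) A (t + 1) =
        ∑ A ∈ (Finset.range t).powerset,
          weight g A t * (penalty (v + u A) + penalty (v + u (insert t A))) := fun v => by
      rw [Finset.range_add_one, Finset.sum_powerset_insert Finset.notMem_range_self,
        ← Finset.sum_add_distrib]
      refine Finset.sum_congr rfl fun A _ => ?_
      have hstep : ∀ B : Finset ℕ, (∀ k < t, k ∈ B ↔ k ∈ A) →
          weight (Function.update g (t + 1) v) B (t + 1) = weight g A t * penalty (v + u B) := by
        intro B hB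
        rw [weight, Finset.prod_range_succ, conv_update_self, ← weight,
          weight_congr (g' := g) (fun k hk => Function.update_of_ne (by omega) _ _) hB]
      rw [hstep A fun _ _ => Iff.rfl,
        hstep (insert t A) fun k hk => by simp [Finset.mem_insert, hk.ne], mul_add]
    have hsum : ∑ v : V, ∑ A ∈ (Finset.range (t + 1)).powerset,
        weight (Function.update g (t + 1) v) A (t + 1) ≤ ∑ _v : V, (1 : ℝ) := by
      simp only [hweight]
      rw [Finset.sum_comm]
      calc _ ≤ ∑ A ∈ (Finset.range t).powerset, weight g A t * Fintype.card V := by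
            refine Finset.sum_le_sum fun A _ => ?_
            rw [← Finset.mul_sum, Finset.sum_add_distrib]
            refine mul_le_mul_of_nonneg_left ?_ (weight_pos g A t).le
            linarith [sum_penalty_add hV (u A), sum_penalty_add hV (u (insert t A))]
        _ ≤ _ := by
            rw [← Finset.sum_mul]
            simpa using mul_le_mul_of_nonneg_right (hg t le_rfl) (Nat.cast_nonneg (Fintype.card V))
    have : Nonempty V := ⟨0⟩
    obtain ⟨v, -, hv⟩ := Finset.exists_le_of_sum_le Finset.univ_nonempty hsum
    refine ⟨Function.update g (t + 1) v, by rwa [Function.update_of_ne (by omega)], fun s hs => ?_⟩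
    rcases hs.eq_or_lt with rfl | hs
    · exact hv
    · refine le_trans (Finset.sum_le_sum fun A _ => le_of_eq ?_) (hg s (by omega))
      exact weight_congr (fun k hk => Function.update_of_ne (by omega) _ _) fun _ _ => Iff.rfl

/-- A sequence of total penalty at most `1` has at least as many nonzero entries as zeros. -/
lemma le_two_mul_card_of_weight_le_one {g : ℕ → V} {A : Finset ℕ} {t : ℕ}
    (h : weight g A t ≤ 1) :
    t ≤ 2 * ((Finset.range t).filter fun m => conv g A (m + 1) ≠ 0).card := by
  have hcard := Finset.card_filter_add_card_filter_not (s := Finset.range t)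
    (fun m => conv g A (m + 1) = 0)
  simp only [Finset.card_range] at hcard
  simp only [weight, penalty, Finset.prod_ite, Finset.prod_const, inv_pow] at h
  rw [← div_eq_mul_inv, div_le_one (by positivity)] at h
  have := (pow_le_pow_iff_right₀ (by norm_num : (1 : ℝ) < 5)).1 h
  simp only [ne_eq]
  omega

/-- A generator all of whose convolutions with binary sequences of length at most `n + 1` starting
with `1` have more nonzero entries than zeros. -/
lemma exists_generator [Fintype V] (hV : 16 ≤ Fintype.card V) (n : ℕ) :
    ∃ g : ℕ → V, ∀ t ≤ n, ∀ A : Finset ℕ,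
      t + 2 ≤ 2 * ((Finset.range (t + 1)).filter fun m => conv g A m ≠ 0).card := by
  obtain ⟨g, hg0, hg⟩ := exists_sum_weight_le_one hV n
  refine ⟨g, fun t ht A => ?_⟩
  have hmem : (Finset.range t).filter (· ∈ A) ∈ (Finset.range t).powerset :=
    Finset.mem_powerset.2 (Finset.filter_subset _ _)
  have hw : weight g A t ≤ 1 := by
    rw [weight_congr (g' := g) (A' := (Finset.range t).filter (· ∈ A)) (fun _ _ => rfl)
      fun k hk => by simp [hk]]
    exact (Finset.single_le_sum (f := fun A => weight g A t)
      (fun A _ => (weight_pos g A t).le) hmem).trans (hg t ht)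
  have hcard := le_two_mul_card_of_weight_le_one hw
  have h0 : conv g A 0 ≠ 0 := by simpa [conv] using hg0
  rw [Finset.card_filter, Finset.sum_range_succ', if_pos h0, ← Finset.card_filter]
  omega

end BinaryTreeCode

/-- Corollary of the main theorem: for every `n ≥ 1` there is a binary tree
code of depth `n` over a 16-letter alphabet (`F₂^4`) with distance parameter
`1/2`: for any two distinct binary strings `a, b` of common length `h ≤ n`
whose longest common prefix has length `h - l`, the labels of the length-`i`
prefixes of `a` and `b` differ for at least `l/2` indices `i` with
`h - l < i ≤ h`. -/
theorem exists_binary_tree_code_sixteen_letters (n : ℕ) (hn : 1 ≤ n) :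
    ∃ L : List Bool → (Fin 4 → ZMod 2),
      ∀ (h l : ℕ) (a b : List Bool),
        a.length = h → b.length = h → h ≤ n → 1 ≤ l → l ≤ h →
        a.take (h - l) = b.take (h - l) →
        a.take (h - l + 1) ≠ b.take (h - l + 1) →
        (l : ℝ) / 2
          ≤ (((Finset.Icc (h - l + 1) h).filter
              (fun i => L (a.take i) ≠ L (b.take i))).card : ℝ) := by
  obtain ⟨g, hg⟩ := BinaryTreeCode.exists_generator (V := Fin 4 → ZMod 2) (by simp) n
  refine ⟨BinaryTreeCode.encode g, fun h l a b ha hb hn hl hlh hpre hne => ?_⟩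
  have hcount := hg (l - 1) (by omega) ((Finset.range h).filter
    fun k => a.getD (h - l + 1 + k) false ≠ b.getD (h - l + 1 + k) false)
  rw [show l - 1 + 1 = l by omega] at hcount
  have hle := Finset.card_le_card_of_injOn (fun m => h - l + m + 1)
    (s := (Finset.range l).filter fun m => BinaryTreeCode.conv g ((Finset.range h).filter
      fun k => a.getD (h - l + 1 + k) false ≠ b.getD (h - l + 1 + k) false) m ≠ 0)
    (t := (Finset.Icc (h - l + 1) h).filter fun i =>
      BinaryTreeCode.encode g (a.take i) ≠ BinaryTreeCode.encode g (b.take i))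
    (fun m hm => by
      obtain ⟨hm, hconv⟩ := Finset.mem_filter.1 hm
      have := Finset.mem_range.1 hm
      refine Finset.mem_filter.2 ⟨Finset.mem_Icc.2 (by constructor <;> dsimp only <;> omega),
        fun heq => hconv ?_⟩
      rw [← BinaryTreeCode.encode_take_sub_encode_take (fun v => CharTwo.add_self_eq_zero v) g
        ha hb (by omega) hpre hne, heq, sub_self])
    (fun m _ m' _ heq => by simp only at heq; omega)
  have hfinal := (show l ≤ l - 1 + 2 by omega).trans (hcount.trans (Nat.mul_le_mul_left 2 hle))
  rw [div_le_iff₀' two_pos]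
  exact_mod_cast hfinal
end

section
/- Let r ≥ 1 be a natural number and let z be a real number with 0 < z ≤ 1/4. Then the series ∑_{m=0}^{∞} (r/(2m+r)) · C(2m+r, m) · z^m converges and equals ((1 − √(1 − 4z))/(2z))^r. -/
/-- The ballot number `r / (2m + r) * C(2m + r, m)` as a difference of binomial coefficients,
with the value `1` at `m = 0` for every `r`, including `r = 0`. -/
def ballotNumber (r : ℕ) : ℕ → ℝ
  | 0 => 1
  | m + 1 => ((2 * m + r + 1).choose (m + 1) : ℝ) - ((2 * m + r + 1).choose m : ℝ)

namespace ballotNumber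

theorem apply_zero (r : ℕ) : ballotNumber r 0 = 1 := rfl

theorem eq_div_mul_choose_succ (r m : ℕ) :
    ballotNumber r (m + 1) =
      (r : ℝ) / (2 * (m + 1 : ℕ) + r) * ((2 * (m + 1) + r).choose (m + 1) : ℝ) := by
  have h1 : ((2 * m + r + 1 + 1 : ℕ) : ℝ) * ((2 * m + r + 1).choose m : ℝ) =
      ((2 * m + r + 1 + 1).choose (m + 1) : ℝ) * (m + 1 : ℕ) := by
    exact_mod_cast Nat.add_one_mul_choose_eq (2 * m + r + 1) m
  have h2 : ((2 * m + r + 1 + 1).choose (m + 1) : ℝ) =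
      ((2 * m + r + 1).choose m : ℝ) + ((2 * m + r + 1).choose (m + 1) : ℝ) := by
    exact_mod_cast Nat.choose_succ_succ (2 * m + r + 1) m
  rw [show 2 * (m + 1) + r = 2 * m + r + 1 + 1 by ring, ballotNumber]
  have hpos : (0 : ℝ) < 2 * (m + 1 : ℕ) + r := by positivity
  rw [div_mul_eq_mul_div, eq_div_iff hpos.ne']
  push_cast at h1 ⊢
  linear_combination (-2) * h1 - (2 * m + 2 + r : ℝ) * h2

theorem eq_div_mul_choose {r : ℕ} (hr : 1 ≤ r) (m : ℕ) :
    ballotNumber r m = (r : ℝ) / (2 * m + r) * ((2 * m + r).choose m : ℝ) := by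
  cases m with
  | zero =>
    have : (r : ℝ) ≠ 0 := by positivity
    simp [ballotNumber, this]
  | succ m => exact eq_div_mul_choose_succ r m

theorem nonneg (r m : ℕ) : 0 ≤ ballotNumber r m := by
  cases m with
  | zero => simp [ballotNumber]
  | succ m =>
    rw [eq_div_mul_choose_succ]
    positivity

theorem zero_succ (m : ℕ) : ballotNumber 0 (m + 1) = 0 := by
  rw [eq_div_mul_choose_succ]
  simp

theorem succ_succ (r m : ℕ) :
    ballotNumber (r + 1) (m + 1) = ballotNumber r (m + 1) + ballotNumber (r + 2) m := by
  cases m with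
  | zero => simp [ballotNumber]
  | succ k =>
    simp only [ballotNumber]
    rw [show 2 * (k + 1) + (r + 1) + 1 = 2 * k + r + 3 + 1 by ring,
      show 2 * (k + 1) + r + 1 = 2 * k + r + 3 by ring,
      show 2 * k + (r + 2) + 1 = 2 * k + r + 3 by ring,
      Nat.choose_succ_succ (2 * k + r + 3) (k + 1), Nat.choose_succ_succ (2 * k + r + 3) k]
    push_cast
    ring

variable {z w : ℝ}

theorem sum_range_le_pow (hz : 0 ≤ z) (hw : 0 ≤ w) (h : w = 1 + z * w ^ 2) (M r : ℕ) :
    ∑ m ∈ Finset.range M, ballotNumber r m * z ^ m ≤ w ^ r := by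
  induction M generalizing r with
  | zero => simpa using pow_nonneg hw r
  | succ M ih =>
    induction r with
    | zero => simp [Finset.sum_range_succ', zero_succ, apply_zero]
    | succ r ihr =>
      have hsplit : ∑ m ∈ Finset.range (M + 1), ballotNumber (r + 1) m * z ^ m =
          ∑ m ∈ Finset.range (M + 1), ballotNumber r m * z ^ m +
            z * ∑ m ∈ Finset.range M, ballotNumber (r + 2) m * z ^ m := by
        rw [Finset.sum_range_succ', Finset.sum_range_succ', Finset.mul_sum, add_right_comm,
          ← Finset.sum_add_distrib]
        congr 1
        exact Finset.sum_congr rfl fun m _ => by rw [succ_succ]; ring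
      calc _ = _ := hsplit
        _ ≤ w ^ r + z * w ^ (r + 2) := by gcongr; exact ih (r + 2)
        _ = w ^ (r + 1) := by linear_combination (-w ^ r) * h

theorem summable_mul_pow (hz : 0 ≤ z) (hw : 0 ≤ w) (h : w = 1 + z * w ^ 2) (r : ℕ) :
    Summable fun m => ballotNumber r m * z ^ m :=
  summable_of_sum_range_le (fun m => mul_nonneg (nonneg r m) (pow_nonneg hz m))
    fun M => sum_range_le_pow hz hw h M r

theorem tsum_succ (hz : 0 ≤ z) (hw : 0 ≤ w) (h : w = 1 + z * w ^ 2) (r : ℕ) :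
    ∑' m, ballotNumber (r + 1) m * z ^ m =
      ∑' m, ballotNumber r m * z ^ m + z * ∑' m, ballotNumber (r + 2) m * z ^ m := by
  have hs := summable_mul_pow hz hw h
  rw [(hs (r + 1)).tsum_eq_zero_add, (hs r).tsum_eq_zero_add, ← tsum_mul_left, add_assoc,
    ← ((summable_nat_add_iff 1).2 (hs r)).tsum_add ((hs (r + 2)).mul_left z)]
  congr 1
  exact tsum_congr fun m => by rw [succ_succ]; ring

/-- The generating function is a power of the root `w ≤ 2` of `w = 1 + z * w ^ 2`: the relative
defects `1 - (∑' m, ballotNumber r m * z ^ m) / w ^ r` lie in `[0, 1]`, vanish at `r = 0` and are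
convex in `r`, hence vanish identically. -/
theorem hasSum_mul_pow (hz : 0 < z) (hw : 1 < w) (hw2 : w ≤ 2) (h : w = 1 + z * w ^ 2) (r : ℕ) :
    HasSum (fun m => ballotNumber r m * z ^ m) (w ^ r) := by
  have hw0 : 0 < w := by linarith
  have hs := summable_mul_pow hz.le hw0.le h
  set E : ℕ → ℝ := fun r => 1 - (∑' m, ballotNumber r m * z ^ m) / w ^ r with hE
  have hE0 : E 0 = 0 := by
    simp [hE, (hs 0).tsum_eq_zero_add, zero_succ, apply_zero]
  have hE_nonneg (r : ℕ) : 0 ≤ E r := by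
    have : ∑' m, ballotNumber r m * z ^ m ≤ w ^ r :=
      (hs r).tsum_le_of_sum_range_le fun M => sum_range_le_pow hz.le hw0.le h M r
    have := (div_le_one (pow_pos hw0 r)).2 this
    simp only [hE]
    linarith
  have hE_le (r : ℕ) : E r ≤ 1 := by
    have : 0 ≤ (∑' m, ballotNumber r m * z ^ m) / w ^ r :=
      div_nonneg (tsum_nonneg fun m => mul_nonneg (nonneg r m) (pow_nonneg hz.le m))
        (pow_nonneg hw0.le r)
    simp only [hE]
    linarith
  have hE_rec (r : ℕ) : (w - 1) * (E (r + 2) - E (r + 1)) = E (r + 1) - E r := by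
    have hF := tsum_succ hz.le hw0.le h r
    have hwr := (pow_pos hw0 r).ne'
    simp only [hE]
    generalize ∑' m, ballotNumber (r + 2) m * z ^ m = c at hF ⊢
    rw [hF, show w - 1 = z * w ^ 2 by linarith]
    generalize ∑' m, ballotNumber r m * z ^ m = a
    rw [pow_add w r 1, pow_add w r 2]
    generalize w ^ r = p at hwr ⊢
    field_simp
    linear_combination (-(a + z * c)) * h
  have hE_step (r : ℕ) : E 1 ≤ E (r + 1) - E r := by
    induction r with
    | zero => simp [hE0]
    | succ r ih =>
      have := hE_rec r
      have := hE_nonneg 1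
      nlinarith
  have hE_ge (r : ℕ) : r * E 1 ≤ E r := by
    induction r with
    | zero => simp [hE0]
    | succ r ih =>
      have := hE_step r
      push_cast
      linarith
  have hE1 : E 1 = 0 := by
    by_contra hne
    have hpos : 0 < E 1 := lt_of_le_of_ne (hE_nonneg 1) (Ne.symm hne)
    obtain ⟨n, hn⟩ := exists_lt_nsmul hpos 1
    rw [nsmul_eq_mul] at hn
    linarith [hE_ge n, hE_le n]
  have hE_zero (r : ℕ) : E r = 0 ∧ E (r + 1) = 0 := by
    induction r with
    | zero => exact ⟨hE0, hE1⟩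
    | succ r ih =>
      refine ⟨ih.2, ?_⟩
      have := hE_rec r
      rw [ih.1, ih.2, sub_zero, sub_zero, mul_eq_zero] at this
      exact this.resolve_left (by linarith)
  have hr : ∑' m, ballotNumber r m * z ^ m = w ^ r :=
    (div_eq_one_iff_eq (pow_pos hw0 r).ne').1 (sub_eq_zero.1 (hE_zero r).1).symm
  exact hr ▸ (hs r).hasSum

end ballotNumber


/-- Generating function of the generalized Catalan (ballot) numbers
(GKP (5.68), (5.70)): for `r ≥ 1` and `0 < z ≤ 1/4`,
`∑_{m≥0} (r/(2m+r))·C(2m+r, m)·z^m = ((1 − √(1−4z))/(2z))^r`. -/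
theorem catalan_generating_function (r : ℕ) (hr : 1 ≤ r) (z : ℝ)
    (hz : 0 < z) (hz' : z ≤ 1 / 4) :
    HasSum (fun m : ℕ => (r : ℝ) / (2 * m + r) * ((2 * m + r).choose m : ℝ) * z ^ m)
      (((1 - Real.sqrt (1 - 4 * z)) / (2 * z)) ^ r) := by
  have hs := Real.sqrt_nonneg (1 - 4 * z)
  have hsq : √(1 - 4 * z) ^ 2 = 1 - 4 * z := Real.sq_sqrt (by linarith)
  simp_rw [← ballotNumber.eq_div_mul_choose hr]
  generalize √(1 - 4 * z) = s at hs hsq ⊢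
  have hs1 : s < 1 := by nlinarith
  obtain rfl : z = (1 - s ^ 2) / 4 := by linarith
  apply ballotNumber.hasSum_mul_pow hz
  · rw [lt_div_iff₀ (by linarith)]
    nlinarith
  · rw [div_le_iff₀ (by linarith)]
    nlinarith
  · have : 1 - s ^ 2 ≠ 0 := by linarith
    field_simp
    ring
end

section
/- For every natural number r ≥ 4, the series ∑_{m=0}^{∞} (r/(2m+r)) · C(2m+r, m) · 2^{(2−r)m} converges and its sum is at most 16. -/
/-- The coefficient of `z ^ m` in the `r`-th power of the Catalan generating function
(for `r = 0` the constant coefficient takes the junk value `0`). -/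
noncomputable def catalanPowCoeff (r m : ℕ) : ℝ :=
  (r : ℝ) / (2 * m + r) * ((2 * m + r).choose m : ℝ)

theorem catalanPowCoeff_nonneg (r m : ℕ) : 0 ≤ catalanPowCoeff r m := by
  unfold catalanPowCoeff; positivity

theorem catalanPowCoeff_zero_left (m : ℕ) : catalanPowCoeff 0 m = 0 := by
  simp [catalanPowCoeff]

theorem catalanPowCoeff_succ_zero (r : ℕ) : catalanPowCoeff (r + 1) 0 = 1 := by
  have : (r : ℝ) + 1 ≠ 0 := by positivity
  simp [catalanPowCoeff, this]

/-- The coefficient form of `C ^ (r + 1) = C ^ r + z * C ^ (r + 2)`. -/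
theorem catalanPowCoeff_succ_succ (r m : ℕ) :
    catalanPowCoeff (r + 1) (m + 1) =
      catalanPowCoeff r (m + 1) + catalanPowCoeff (r + 2) m := by
  unfold catalanPowCoeff
  have e₁ : 2 * (m + 1) + (r + 1) = (2 * m + r + 2) + 1 := by ring
  have e₂ : 2 * (m + 1) + r = 2 * m + r + 2 := by ring
  have e₃ : 2 * m + (r + 2) = 2 * m + r + 2 := by ring
  rw [e₁, e₂, e₃, Nat.choose_succ_succ]
  have h := Nat.choose_succ_right_eq (2 * m + r + 2) m
  rw [show 2 * m + r + 2 - m = m + r + 2 by lia] at h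
  have h' : ((2 * m + r + 2).choose (m + 1) : ℝ) * (m + 1) =
      ((2 * m + r + 2).choose m : ℝ) * (m + r + 2) := by exact_mod_cast h
  have h'' := eq_div_of_mul_eq (by positivity) h'
  push_cast
  rw [h'']
  field_simp
  ring

/-- Partial sums of the `r`-th power of the Catalan series at `z` are bounded by `c ^ r` for any
supersolution `c` of the quadratic equation `c = 1 + z * c ^ 2`. -/
theorem one_add_sum_catalanPowCoeff_le_pow {z c : ℝ} (hz : 0 ≤ z) (hzc : 1 + z * c ^ 2 ≤ c)
    (M r : ℕ) :
    1 + ∑ m ∈ Finset.range M, catalanPowCoeff r (m + 1) * z ^ (m + 1) ≤ c ^ r := by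
  have hc : 1 ≤ c := by nlinarith [mul_nonneg hz (sq_nonneg c)]
  induction M generalizing r with
  | zero => simpa using one_le_pow₀ hc
  | succ M ihM =>
    induction r with
    | zero => simp [catalanPowCoeff_zero_left]
    | succ r ihr =>
      have split : ∑ m ∈ Finset.range (M + 1), catalanPowCoeff (r + 1) (m + 1) * z ^ (m + 1) =
          ∑ m ∈ Finset.range (M + 1), catalanPowCoeff r (m + 1) * z ^ (m + 1) +
            z * (1 + ∑ m ∈ Finset.range M, catalanPowCoeff (r + 2) (m + 1) * z ^ (m + 1)) := by
        have : 1 + ∑ m ∈ Finset.range M, catalanPowCoeff (r + 2) (m + 1) * z ^ (m + 1) =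
            ∑ m ∈ Finset.range (M + 1), catalanPowCoeff (r + 2) m * z ^ m := by
          rw [Finset.sum_range_succ', catalanPowCoeff_succ_zero]; ring
        rw [this, Finset.mul_sum, ← Finset.sum_add_distrib]
        refine Finset.sum_congr rfl fun m _ => ?_
        rw [catalanPowCoeff_succ_succ]; ring
      calc _ ≤ c ^ r + z * c ^ (r + 2) := by
            rw [split, ← add_assoc]
            exact add_le_add ihr (mul_le_mul_of_nonneg_left (ihM (r + 2)) hz)
        _ = c ^ r * (1 + z * c ^ 2) := by ring
        _ ≤ c ^ r * c := by gcongr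
        _ = c ^ (r + 1) := (pow_succ c r).symm

theorem sum_catalanPowCoeff_le_pow {z c : ℝ} (hz : 0 ≤ z) (hzc : 1 + z * c ^ 2 ≤ c)
    {r : ℕ} (hr : r ≠ 0) (M : ℕ) :
    ∑ m ∈ Finset.range M, catalanPowCoeff r m * z ^ m ≤ c ^ r := by
  obtain ⟨r, rfl⟩ := Nat.exists_eq_succ_of_ne_zero hr
  calc _ ≤ ∑ m ∈ Finset.range (M + 1), catalanPowCoeff (r + 1) m * z ^ m := by
        rw [Finset.sum_range_succ]
        exact le_add_of_nonneg_right (mul_nonneg (catalanPowCoeff_nonneg _ _) (pow_nonneg hz _))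
    _ = 1 + ∑ m ∈ Finset.range M, catalanPowCoeff (r + 1) (m + 1) * z ^ (m + 1) := by
        rw [Finset.sum_range_succ', catalanPowCoeff_succ_zero]; ring
    _ ≤ _ := one_add_sum_catalanPowCoeff_le_pow hz hzc M (r + 1)

theorem one_add_sixteen_div_two_pow_pow_le {r : ℕ} (hr : 4 ≤ r) :
    (1 + (16 : ℝ) / 2 ^ r) ^ r ≤ 16 := by
  induction r, hr using Nat.le_induction with
  | base => norm_num
  | succ r hr ih =>
    have hx0 : (0 : ℝ) ≤ 16 / 2 ^ r := by positivity
    have hx1 : (16 : ℝ) / 2 ^ r ≤ 1 := by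
      rw [div_le_one (by positivity)]
      calc (16 : ℝ) = 2 ^ 4 := by norm_num
        _ ≤ 2 ^ r := pow_le_pow_right₀ (by norm_num) hr
    have hhalf : (16 : ℝ) / 2 ^ (r + 1) = 16 / 2 ^ r / 2 := by rw [pow_succ, div_div]
    rw [hhalf]
    set x : ℝ := 16 / 2 ^ r
    have hr' : (4 : ℝ) ≤ r := by exact_mod_cast hr
    calc (1 + x / 2) ^ (r + 1) = (1 + x / 2) ^ r * (1 + x / 2) := pow_succ _ _
      _ ≤ (1 + x / 2) ^ r * (1 + x / 4) ^ r := by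
          gcongr
          calc 1 + x / 2 ≤ 1 + r * (x / 4) := by nlinarith
            _ ≤ (1 + x / 4) ^ r := one_add_mul_le_pow (by linarith) r
      _ = ((1 + x / 2) * (1 + x / 4)) ^ r := (mul_pow _ _ _).symm
      _ ≤ (1 + x) ^ r := by gcongr; nlinarith
      _ ≤ 16 := ih


/-- For `r ≥ 4`, the series `∑_{m≥0} (r/(2m+r))·C(2m+r, m)·2^{(2−r)m}`
converges and its sum is at most `16`.  (Here `2^{(2−r)m} = (4/2^r)^m`.) -/
theorem catalan_series_le_sixteen (r : ℕ) (hr : 4 ≤ r) :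
    Summable (fun m : ℕ =>
        (r : ℝ) / (2 * m + r) * ((2 * m + r).choose m : ℝ) * ((4 : ℝ) / 2 ^ r) ^ m) ∧
      ∑' m : ℕ,
          (r : ℝ) / (2 * m + r) * ((2 * m + r).choose m : ℝ) * ((4 : ℝ) / 2 ^ r) ^ m
        ≤ 16 := by
  set z : ℝ := 4 / 2 ^ r with hz_def
  have hz : 0 ≤ z := by positivity
  have hz4 : 4 * z = 16 / 2 ^ r := by rw [hz_def]; ring
  have hz1 : 4 * z ≤ 1 := by
    rw [hz4, div_le_one (by positivity)]
    calc (16 : ℝ) = 2 ^ 4 := by norm_num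
      _ ≤ 2 ^ r := pow_le_pow_right₀ (by norm_num) hr
  have hzc : 1 + z * (1 + 4 * z) ^ 2 ≤ 1 + 4 * z := by
    nlinarith [mul_le_mul_of_nonneg_left (show (1 + 4 * z) ^ 2 ≤ 4 by nlinarith) hz]
  have hnonneg (m : ℕ) : 0 ≤ catalanPowCoeff r m * z ^ m :=
    mul_nonneg (catalanPowCoeff_nonneg r m) (pow_nonneg hz m)
  have hsum (M : ℕ) : ∑ m ∈ Finset.range M, catalanPowCoeff r m * z ^ m ≤ 16 :=
    (sum_catalanPowCoeff_le_pow hz hzc (by lia) M).trans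
      (hz4 ▸ one_add_sixteen_div_two_pow_pow_le hr)
  exact ⟨summable_of_sum_range_le hnonneg hsum, Real.tsum_le_of_sum_range_le hnonneg hsum⟩
end
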